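/- Let F(s) = ξ(2)·ξ(3s)/(3s−3) − ξ(2)·ξ(3s−2)/(3s) + (1/3)·ξ(3s−1)/(3s−3) − (1/3)·ξ(3s−1)/(3s) + (1/2)·ξ(3s−2)/(3s−1) − (1/2)·ξ(3s)/(3s−2). Then every zero of F lies on the central line: for every complex s with s ∉ {0, 1/3, 2/3, 1}, if F(s) = 0 then Re s = 1/2. -/

import Mathlib

open Complex

local notation "ξ" => completedRiemannZeta

/-- Weng's zeta function `ξ_{SL(3);ℚ}(s)`. -/
noncomputable def wengSL3 (s : ℂ) : ℂ :=
  ξ 2 * ξ (3*s) / (3*s - 3) - ξ 2 * ξ (3*s - 2) / (3*s)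
    + (1/3) * ξ (3*s - 1) / (3*s - 3) - (1/3) * ξ (3*s - 1) / (3*s)
    + (1/2) * ξ (3*s - 2) / (3*s - 1) - (1/2) * ξ (3*s) / (3*s - 2)

section

open Filter Topology MeasureTheory Set Asymptotics Bornology
open scoped ComplexConjugate Real

/-- The entire function `w (w - 1) ξ(w)`. -/
noncomputable def entireXi (w : ℂ) : ℂ := w * (w - 1) * completedRiemannZeta₀ w + 1

lemma entireXi_eq {w : ℂ} (h0 : w ≠ 0) (h1 : w ≠ 1) : entireXi w = w * (w - 1) * ξ w := by
  have h1' : 1 - w ≠ 0 := sub_ne_zero.mpr h1.symm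
  rw [entireXi, completedRiemannZeta_eq]
  field_simp
  ring

@[fun_prop]
lemma differentiable_entireXi : Differentiable ℂ entireXi := by
  unfold entireXi
  have := differentiable_completedZeta₀
  fun_prop

lemma entireXi_one_sub (w : ℂ) : entireXi (1 - w) = entireXi w := by
  rw [entireXi, entireXi, completedRiemannZeta₀_one_sub]
  ring

lemma entireXi_one : entireXi 1 = 1 := by simp [entireXi]

lemma entireXi_eq_zeta {w : ℂ} (h : 0 < w.re) (h1 : w ≠ 1) :
    entireXi w = w * (w - 1) * (Gammaℝ w * riemannZeta w) := by
  have h0 : w ≠ 0 := by rintro rfl; simp at h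
  rw [entireXi_eq h0 h1, riemannZeta_def_of_ne_zero h0, mul_div_cancel₀ _ (Gammaℝ_ne_zero_of_re_pos h)]

lemma completedRiemannZeta_two : ξ 2 = π / 6 := by
  have h : Gammaℝ 2 = (π : ℂ)⁻¹ := by
    rw [Gammaℝ_def]
    norm_num [cpow_neg_one]
  have h2 := riemannZeta_def_of_ne_zero (s := 2) two_ne_zero
  rw [riemannZeta_two, h] at h2
  have : (π : ℂ) ≠ 0 := ofReal_ne_zero.mpr Real.pi_ne_zero
  field_simp at h2 ⊢
  rw [← h2]

lemma entireXi_two : entireXi 2 = π / 3 := by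
  rw [entireXi_eq two_ne_zero (by norm_num), completedRiemannZeta_two]
  ring

lemma Gammaℝ_conj (w : ℂ) : Gammaℝ (conj w) = conj (Gammaℝ w) := by
  have h := cpow_conj (π : ℂ) (-w / 2)
    (by simpa [arg_ofReal_of_nonneg Real.pi_pos.le] using Real.pi_ne_zero.symm)
  rw [conj_ofReal] at h
  have h2 : conj (2 : ℂ) = 2 := map_ofNat _ 2
  rw [Gammaℝ_def, Gammaℝ_def, map_mul, ← h, ← Gamma_conj]
  simp [h2]

lemma entireXi_conj (w : ℂ) : entireXi (conj w) = conj (entireXi w) := by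
  have key : ∀ w : ℂ, 0 < w.re → entireXi (conj w) = conj (entireXi w) := by
    intro w hw
    by_cases h1 : w = 1
    · simp [h1, entireXi_one]
    · rw [entireXi_eq_zeta hw h1, entireXi_eq_zeta (by simpa using hw)
        (by simpa using (map_ne_one_iff _ (starRingEnd ℂ).injective).mpr h1)]
      simp [Gammaℝ_conj]
  rcases lt_or_ge 0 w.re with h | h
  · exact key w h
  · have := key (1 - w) (by simp; linarith)
    rwa [map_sub, map_one, entireXi_one_sub, entireXi_one_sub] at this

lemma norm_entireXi_reflect (w : ℂ) (c : ℝ) (hc : w.re = c / 2) (v : ℂ) (hv : v = w + (1 - c)) :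
    ‖entireXi v‖ = ‖entireXi w‖ := by
  have : v = 1 - conj w := by
    apply Complex.ext
    · simp [hv]; linarith
    · simp [hv]
  rw [this, entireXi_one_sub, entireXi_conj, norm_conj]

lemma entireXi_ne_zero {w : ℂ} (h : 1 ≤ w.re) : entireXi w ≠ 0 := by
  by_cases h1 : w = 1
  · simp [h1, entireXi_one]
  · have h0 : w ≠ 0 := by rintro rfl; norm_num at h
    rw [entireXi_eq_zeta (by linarith) h1]
    exact mul_ne_zero (mul_ne_zero h0 (sub_ne_zero.mpr h1))
      (mul_ne_zero (Gammaℝ_ne_zero_of_re_pos (by linarith)) (riemannZeta_ne_zero_of_one_le_re h))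

/-- A Mellin transform that converges at both ends of a vertical strip is bounded on it. -/
lemma exists_norm_mellin_le {f : ℝ → ℂ} {a b : ℝ} (ha : MellinConvergent f a)
    (hb : MellinConvergent f b) :
    ∃ M, ∀ s : ℂ, a ≤ s.re → s.re ≤ b → ‖mellin f s‖ ≤ M := by
  refine ⟨∫ t in Ioi (0 : ℝ), (‖(t : ℂ) ^ ((a : ℂ) - 1) • f t‖ + ‖(t : ℂ) ^ ((b : ℂ) - 1) • f t‖),
    fun s h1 h2 => ?_⟩
  refine norm_integral_le_of_norm_le (ha.norm.add hb.norm) ?_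
  refine (ae_restrict_iff' measurableSet_Ioi).mpr (.of_forall fun t ht => ?_)
  have ht : 0 < t := ht
  simp only [norm_smul, norm_cpow_eq_rpow_re_of_pos ht, ← add_mul, sub_re, ofReal_re, one_re]
  gcongr
  rcases le_total 1 t with h | h
  · exact (Real.rpow_le_rpow_of_exponent_le h (by linarith)).trans
      (le_add_of_nonneg_left (by positivity))
  · exact (Real.rpow_le_rpow_of_exponent_ge ht h (by linarith)).trans
      (le_add_of_nonneg_right (by positivity))

lemma exists_norm_completedRiemannZeta₀_le (a b : ℝ) :
    ∃ M, ∀ s : ℂ, a ≤ s.re → s.re ≤ b → ‖completedRiemannZeta₀ s‖ ≤ M := by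
  have hconv := (HurwitzZeta.hurwitzEvenFEPair 0).isStrongFEPair_toStrongFEPair.hasMellin
  obtain ⟨M, hM⟩ := exists_norm_mellin_le (hconv ((a / 2 : ℝ) : ℂ)).1 (hconv ((b / 2 : ℝ) : ℂ)).1
  refine ⟨M / 2, fun s h1 h2 => ?_⟩
  have h := hM (s / 2) (by simp; linarith) (by simp; linarith)
  have e : completedRiemannZeta₀ s = mellin (HurwitzZeta.hurwitzEvenFEPair 0).f_modif (s / 2) / 2 := rfl
  rw [e, norm_div]
  simp only [Complex.norm_ofNat]
  gcongr
  exact h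

lemma exists_norm_entireXi_le (a b : ℝ) :
    ∃ C, 0 < C ∧ ∀ s : ℂ, a ≤ s.re → s.re ≤ b → ‖entireXi s‖ ≤ Real.exp (C * (1 + ‖s‖)) := by
  obtain ⟨M, hM⟩ := exists_norm_completedRiemannZeta₀_le a b
  refine ⟨|M| + 2, by positivity, fun s h1 h2 => ?_⟩
  have h := (hM s h1 h2).trans (le_abs_self M)
  have hs : ‖s - 1‖ ≤ 1 + ‖s‖ := by simpa [add_comm] using norm_sub_le s 1
  calc ‖entireXi s‖ ≤ ‖s‖ * ‖s - 1‖ * ‖completedRiemannZeta₀ s‖ + 1 := by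
        refine (norm_add_le _ _).trans ?_
        simp
    _ ≤ ‖s‖ * (1 + ‖s‖) * |M| + 1 := by gcongr
    _ ≤ (1 + ‖s‖) * (1 + ‖s‖) * (1 + |M|) := by
        nlinarith [norm_nonneg s, abs_nonneg M, mul_nonneg (norm_nonneg s) (norm_nonneg s),
          mul_nonneg (norm_nonneg s) (abs_nonneg M)]
    _ ≤ Real.exp ‖s‖ * Real.exp ‖s‖ * Real.exp |M| := by
        gcongr <;> rw [add_comm] <;> exact Real.add_one_le_exp _
    _ = Real.exp (2 * ‖s‖ + |M|) := by rw [← Real.exp_add, ← Real.exp_add]; ring_nf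
    _ ≤ _ := by
        gcongr
        nlinarith [norm_nonneg s, abs_nonneg M, mul_nonneg (norm_nonneg s) (abs_nonneg M)]

lemma exists_norm_Gamma_le {a b : ℝ} (ha : 0 < a) :
    ∃ M, 0 < M ∧ ∀ s : ℂ, a ≤ s.re → s.re ≤ b → ‖Gamma s‖ ≤ M := by
  rcases lt_or_ge b a with hab | hab
  · exact ⟨1, one_pos, fun s h1 h2 => by linarith⟩
  have hconv : ∀ c : ℝ, 0 < c → MellinConvergent (fun x => ((Real.exp (-x) : ℝ) : ℂ)) c := by
    intro c hc
    have := GammaIntegral_convergent (s := c) (by simpa using hc)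
    unfold MellinConvergent
    simpa [mul_comm] using this
  obtain ⟨M, hM⟩ := exists_norm_mellin_le (hconv a ha) (hconv b (ha.trans_le hab))
  refine ⟨|M| + 1, by positivity, fun s h1 h2 => ?_⟩
  rw [Gamma_eq_integral (by linarith), GammaIntegral_eq_mellin]
  exact ((hM s h1 h2).trans (le_abs_self M)).trans (by linarith)

lemma norm_sin_le_exp_norm (u : ℂ) : ‖Complex.sin u‖ ≤ Real.exp ‖u‖ := by
  rw [Complex.sin, norm_div, norm_mul, norm_I, mul_one, Complex.norm_ofNat, div_le_iff₀ two_pos]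
  refine (norm_sub_le _ _).trans ?_
  have h1 : ‖cexp (-u * I)‖ ≤ Real.exp ‖u‖ := (norm_exp_le_exp_norm _).trans (by simp)
  have h2 : ‖cexp (u * I)‖ ≤ Real.exp ‖u‖ := (norm_exp_le_exp_norm _).trans (by simp)
  linarith

lemma exists_norm_Gamma_inv_le :
    ∃ C, 0 < C ∧ ∀ z : ℂ, -1 / 2 ≤ z.re → z.re ≤ 3 / 2 → 1 / 2 ≤ |z.im| →
      ‖(Gamma z)⁻¹‖ ≤ Real.exp (C * (1 + ‖z‖)) := by
  obtain ⟨M, hM0, hM⟩ := exists_norm_Gamma_le (a := 3 / 2) (b := 7 / 2) (by norm_num)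
  refine ⟨4 * M + π, by positivity, fun z h1 h2 h3 => ?_⟩
  have him : z.im ≠ 0 := by
    intro h; rw [h] at h3; norm_num at h3
  have hs : Complex.sin (π * z) ≠ 0 := by
    rw [Complex.sin_ne_zero_iff]
    intro k hk
    have := congrArg Complex.im hk
    simp [him, Real.pi_ne_zero] at this
  have hπ : (π : ℂ) ≠ 0 := ofReal_ne_zero.mpr Real.pi_ne_zero
  have hg := Gamma_mul_Gamma_one_sub z
  have hG0 : Gamma z ≠ 0 := by
    intro h
    rw [h, zero_mul, eq_comm, div_eq_zero_iff] at hg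
    tauto
  have n1 : 1 / 2 ≤ ‖1 - z‖ := h3.trans (by simpa using abs_im_le_norm (1 - z))
  have n2 : 1 / 2 ≤ ‖2 - z‖ := h3.trans (by simpa using abs_im_le_norm (2 - z))
  have e1 : (2 - z) * ((1 - z) * Gamma (1 - z)) = Gamma (3 - z) := by
    rw [← Gamma_add_one (1 - z), show 1 - z + 1 = 2 - z by ring, ← Gamma_add_one (2 - z)]
    · ring_nf
    · rw [← norm_pos_iff]; linarith
    · rw [← norm_pos_iff]; linarith
  have hinv : (Gamma z)⁻¹ = Gamma (1 - z) * Complex.sin (π * z) / π := by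
    have hg' := (eq_div_iff hs).mp hg
    rw [eq_div_iff hπ, inv_mul_eq_iff_eq_mul₀ hG0]
    linear_combination -hg'
  have hb : ‖Gamma (1 - z)‖ ≤ 4 * M := by
    have h := hM (3 - z) (by simp; linarith) (by simp; linarith)
    rw [← e1, norm_mul, norm_mul] at h
    have : 1 / 2 * (1 / 2 * ‖Gamma (1 - z)‖) ≤ ‖2 - z‖ * (‖1 - z‖ * ‖Gamma (1 - z)‖) := by gcongr
    linarith
  have hsin := norm_sin_le_exp_norm (π * z)
  rw [norm_mul, norm_real, Real.norm_of_nonneg Real.pi_pos.le] at hsin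
  rw [hinv, norm_div, norm_mul, norm_real, Real.norm_of_nonneg Real.pi_pos.le]
  calc ‖Gamma (1 - z)‖ * ‖Complex.sin (π * z)‖ / π
      ≤ ‖Gamma (1 - z)‖ * ‖Complex.sin (π * z)‖ / 1 := by
        gcongr; linarith [Real.pi_gt_three]
    _ ≤ Real.exp (4 * M) * Real.exp (π * ‖z‖) := by
        rw [div_one]
        gcongr
        linarith [Real.add_one_le_exp (4 * M)]
    _ = Real.exp (4 * M + π * ‖z‖) := (Real.exp_add _ _).symm
    _ ≤ _ := by
        gcongr
        nlinarith [norm_nonneg z, Real.pi_pos]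

lemma exists_norm_Gammaℝ_inv_le :
    ∃ C, 0 < C ∧ ∀ w : ℂ, -1 ≤ w.re → w.re ≤ 3 → 1 ≤ |w.im| →
      ‖(Gammaℝ w)⁻¹‖ ≤ Real.exp (C * (1 + ‖w‖)) := by
  obtain ⟨C, hC0, hC⟩ := exists_norm_Gamma_inv_le
  have hl := Real.log_pos (by linarith [Real.pi_gt_three] : 1 < π)
  refine ⟨C + Real.log π * 2, by positivity, fun w h1 h2 h3 => ?_⟩
  have h := hC (w / 2) (by simp; linarith) (by simp; linarith) (by simp [abs_div]; linarith)
  rw [norm_div, Complex.norm_ofNat] at h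
  rw [Gammaℝ_def, mul_inv, norm_mul, norm_inv, norm_cpow_eq_rpow_re_of_pos Real.pi_pos,
    Real.rpow_def_of_pos Real.pi_pos, ← Real.exp_neg]
  refine (mul_le_mul_of_nonneg_left h (Real.exp_nonneg _)).trans ?_
  rw [← Real.exp_add]
  gcongr
  have : -(-w / 2).re = w.re / 2 := by simp; ring
  rw [neg_mul_eq_mul_neg, this]
  nlinarith [norm_nonneg w]

lemma exists_norm_riemannZeta_le :
    ∃ C, 0 < C ∧ ∀ w : ℂ, 1 / 2 ≤ w.re → w.re ≤ 3 → 1 ≤ |w.im| →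
      ‖riemannZeta w‖ ≤ Real.exp (C * (1 + ‖w‖)) := by
  obtain ⟨C, hC0, hC⟩ := exists_norm_Gammaℝ_inv_le
  obtain ⟨D, hD0, hD⟩ := exists_norm_entireXi_le (1 / 2) 3
  refine ⟨C + D, by positivity, fun w h1 h2 h3 => ?_⟩
  have h0 : 1 ≤ ‖w‖ := h3.trans (abs_im_le_norm w)
  have h0' : 1 ≤ ‖w - 1‖ := h3.trans (by simpa using abs_im_le_norm (w - 1))
  have w0 : w ≠ 0 := by rw [← norm_pos_iff]; linarith
  have w1 : w - 1 ≠ 0 := by rw [← norm_pos_iff]; linarith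
  have hg := Gammaℝ_ne_zero_of_re_pos (by linarith : 0 < w.re)
  have e : riemannZeta w = entireXi w * (Gammaℝ w)⁻¹ / (w * (w - 1)) := by
    rw [entireXi_eq_zeta (by linarith) (sub_ne_zero.mp w1)]
    field_simp
  rw [e, norm_div, norm_mul, norm_mul]
  calc _ ≤ ‖entireXi w‖ * ‖(Gammaℝ w)⁻¹‖ / (1 * 1) := by gcongr
    _ ≤ Real.exp (D * (1 + ‖w‖)) * Real.exp (C * (1 + ‖w‖)) := by
        rw [mul_one, div_one]
        gcongr
        · exact hD w h1 h2
        · exact hC w (by linarith) h2 h3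
    _ = _ := by rw [← Real.exp_add]; ring_nf

lemma norm_riemannZeta_sub_one_le {w : ℂ} (h : 2 ≤ w.re) :
    ‖riemannZeta w - 1‖ ≤ π ^ 2 / 6 - 1 := by
  have hsum : Summable (fun n : ℕ => 1 / ((n : ℝ) + 1) ^ 2) := by
    simpa using (summable_nat_add_iff 1).mpr (Real.summable_one_div_nat_pow.mpr one_lt_two)
  have ht : ∑' n : ℕ, 1 / ((n : ℝ) + 1) ^ 2 = π ^ 2 / 6 := by
    have := hasSum_zeta_two.tsum_eq
    rw [hasSum_zeta_two.summable.tsum_eq_zero_add] at this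
    simpa using this
  have hbound : ∀ n : ℕ, ‖1 / ((n : ℂ) + 1) ^ w‖ ≤ 1 / ((n : ℝ) + 1) ^ 2 := by
    intro n
    have hn : (0 : ℝ) < (n : ℝ) + 1 := by positivity
    have : ((n : ℂ) + 1) = ((n + 1 : ℝ) : ℂ) := by push_cast; rfl
    rw [norm_div, norm_one, this, norm_cpow_eq_rpow_re_of_pos hn]
    gcongr
    rw [← Real.rpow_natCast]
    exact Real.rpow_le_rpow_of_exponent_le (by linarith [n.cast_nonneg (α := ℝ)]) (by exact_mod_cast h)
  have hs : Summable (fun n : ℕ => 1 / ((n : ℂ) + 1) ^ w) := .of_norm_bounded hsum hbound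
  rw [zeta_eq_tsum_one_div_nat_add_one_cpow (by linarith), hs.tsum_eq_zero_add, ← ht,
    hsum.tsum_eq_zero_add]
  simp only [Nat.cast_zero, zero_add, one_cpow, ne_eq, one_ne_zero, not_false_eq_true, div_self,
    add_sub_cancel_left, one_pow]
  exact tsum_of_norm_bounded ((summable_nat_add_iff 1).mpr hsum).hasSum fun n => hbound _

/-- The `3-4-1` inequality. -/
lemma one_le_norm_riemannZeta_product {x : ℝ} (hx : 0 < x) (y : ℝ) :
    1 ≤ ‖riemannZeta (1 + x)‖ ^ 3 * ‖riemannZeta (1 + x + I * y)‖ ^ 4 *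
      ‖riemannZeta (1 + x + 2 * I * y)‖ := by
  simpa [DirichletCharacter.LFunctionTrivChar, DirichletCharacter.LFunction_modOne_eq] using
    DirichletCharacter.norm_LFunction_product_ge_one (N := 1) 1 hx y

lemma exists_norm_riemannZeta_near_one_le :
    ∃ K, 1 ≤ K ∧ ∀ x : ℝ, 0 < x → x ≤ 1 → ‖riemannZeta (1 + x)‖ ≤ K / x := by
  obtain ⟨K, hK⟩ := (isCompact_Icc (a := (0 : ℝ)) (b := 1)).exists_bound_of_continuousOn
    (f := fun x : ℝ => riemannZeta₁ (1 + x))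
    (differentiable_riemannZeta₁.continuous.comp (by fun_prop)).continuousOn
  refine ⟨|K| + 1, by linarith [abs_nonneg K], fun x h0 h1 => ?_⟩
  have hx : (x : ℂ) ≠ 0 := ofReal_ne_zero.mpr h0.ne'
  rw [riemannZeta_eq_inv_sub_mul (by simpa using hx), norm_mul, add_sub_cancel_left, norm_inv,
    norm_real, Real.norm_of_nonneg h0.le, le_div_iff₀ h0]
  field_simp
  linarith [hK x ⟨h0.le, h1⟩, le_abs_self K]

lemma exists_norm_riemannZeta_sub_le :
    ∃ C, 0 < C ∧ ∀ x x' t : ℝ, 0 ≤ x → x ≤ 1 → 0 ≤ x' → x' ≤ 1 → 2 ≤ |t| →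
      ‖riemannZeta (1 + x' + I * t) - riemannZeta (1 + x + I * t)‖ ≤
        2 * Real.exp (C * (4 + 2 * |t|)) * |x' - x| ∧
      ‖riemannZeta (1 + x + 2 * I * t)‖ ≤ 2 * Real.exp (C * (4 + 2 * |t|)) := by
  obtain ⟨C, hC0, hC⟩ := exists_norm_riemannZeta_le
  refine ⟨C, hC0, fun x x' t h0 h1 h0' h1' ht => ⟨?_, ?_⟩⟩
  · have hconv : Convex ℝ (Icc (1 : ℝ) 2 ×ℂ {t})  := by
      rw [reProdIm]
      exact ((convex_Icc _ _).linear_preimage reLm).inter ((convex_singleton t).linear_preimage imLm)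
    have hmem : ∀ y : ℝ, 0 ≤ y → y ≤ 1 → (1 + y + I * t : ℂ) ∈ Icc (1 : ℝ) 2 ×ℂ {t} := by
      intro y hy hy'
      simp only [mem_reProdIm, mem_Icc, mem_singleton_iff]
      refine ⟨⟨by simp; linarith, by simp; linarith⟩, by simp⟩
    have key := hconv.norm_image_sub_le_of_norm_deriv_le (f := riemannZeta)
      (C := 2 * Real.exp (C * (4 + 2 * |t|))) ?_ ?_ (hmem x h0 h1) (hmem x' h0' h1')
    · refine key.trans (le_of_eq ?_)
      rw [show (1 + x' + I * t - (1 + x + I * t) : ℂ) = ((x' - x : ℝ) : ℂ) by push_cast; ring,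
        norm_real, Real.norm_eq_abs]
    · rintro z ⟨-, hz⟩
      refine differentiableAt_riemannZeta ?_
      rintro rfl
      simp only [mem_preimage, one_im, mem_singleton_iff] at hz
      rw [← hz] at ht; norm_num at ht
    · rintro z ⟨⟨hz1, hz2⟩, hz⟩
      simp only [mem_preimage, mem_singleton_iff] at hz
      have hnear : ∀ u ∈ Metric.closedBall z (1 / 2), 1 / 2 ≤ u.re ∧ u.re ≤ 5 / 2 ∧ 3 / 2 ≤ |u.im| ∧
          ‖u‖ ≤ 5 / 2 + |t| := by
        intro u hu
        rw [mem_closedBall_iff_norm] at hu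
        have a1 := (abs_re_le_norm (u - z)).trans hu
        have a2 := (abs_im_le_norm (u - z)).trans hu
        rw [sub_re, abs_le] at a1
        rw [sub_im, hz] at a2
        have a3 := abs_sub_abs_le_abs_sub t u.im
        rw [abs_sub_comm] at a3
        have a4 : ‖z‖ ≤ |z.re| + |z.im| := norm_le_abs_re_add_abs_im z
        rw [hz, abs_of_nonneg (by linarith)] at a4
        have a5 : ‖u‖ ≤ ‖z‖ + ‖u - z‖ := by simpa using norm_add_le z (u - z)
        exact ⟨by linarith, by linarith, by linarith, by linarith⟩
      have hd : DiffContOnCl ℂ riemannZeta (Metric.ball z (1 / 2)) := by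
        refine DifferentiableOn.diffContOnCl_ball (U := Metric.closedBall z (1 / 2)) ?_ subset_rfl
        intro u hu
        refine (differentiableAt_riemannZeta ?_).differentiableWithinAt
        rintro rfl
        have := (hnear 1 hu).2.2.1
        norm_num at this
      have := norm_deriv_le_of_forall_mem_sphere_norm_le (by norm_num : (0 : ℝ) < 1 / 2) hd
        (C := Real.exp (C * (4 + 2 * |t|))) fun u hu => by
          obtain ⟨b1, b2, b3, b4⟩ := hnear u (Metric.sphere_subset_closedBall hu)
          refine (hC u b1 (by linarith) (by linarith)).trans ?_
          exact Real.exp_le_exp.mpr (mul_le_mul_of_nonneg_left (by linarith [abs_nonneg t]) hC0.le)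
      refine this.trans (le_of_eq (by ring))
  · have hn : ‖(1 + x + 2 * I * t : ℂ)‖ ≤ 3 + 2 * |t| := by
      refine (norm_le_abs_re_add_abs_im _).trans ?_
      simp only [add_re, one_re, ofReal_re, mul_re, re_ofNat, I_re, mul_zero, im_ofNat, I_im,
        mul_one, sub_self, zero_mul, mul_im, add_zero, ofReal_im, add_im, one_im, zero_add,
        abs_mul, Nat.abs_ofNat]
      rw [abs_of_nonneg (by linarith)]
      linarith
    refine (hC _ (by simp; linarith) (by simp; linarith) (by simp [abs_mul]; linarith)).trans ?_
    refine le_trans ?_ (le_mul_of_one_le_left (Real.exp_nonneg _) one_le_two)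
    exact Real.exp_le_exp.mpr (mul_le_mul_of_nonneg_left (by linarith) hC0.le)

lemma exists_norm_riemannZeta_inv_le :
    ∃ C, 0 < C ∧ ∀ w : ℂ, 1 ≤ w.re → w.re ≤ 2 → 2 ≤ |w.im| →
      ‖(riemannZeta w)⁻¹‖ ≤ Real.exp (C * (1 + ‖w‖)) := by
  obtain ⟨C, hC0, hC⟩ := exists_norm_riemannZeta_sub_le
  obtain ⟨K, hK1, hK⟩ := exists_norm_riemannZeta_near_one_le
  refine ⟨256 * K ^ 3 + 16 * C, by positivity, fun w h1 h2 h3 => ?_⟩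
  set M := 2 * Real.exp (C * (4 + 2 * |w.im|)) with hM
  have hM1 : 1 ≤ M := by
    have : 1 ≤ Real.exp (C * (4 + 2 * |w.im|)) := Real.one_le_exp (by positivity)
    linarith
  set ε := 1 / (16 * K ^ 3 * M ^ 5) with hε
  have hε0 : 0 < ε := by positivity
  have hε1 : ε ≤ 1 := by
    rw [hε, div_le_one (by positivity)]
    have : 1 ≤ K ^ 3 := one_le_pow₀ hK1
    have : 1 ≤ M ^ 5 := one_le_pow₀ hM1
    nlinarith
  have hw : w = 1 + ((w.re - 1 : ℝ) : ℂ) + I * w.im := by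
    apply Complex.ext <;> simp
  have hlow : ε * M ≤ ‖riemannZeta w‖ := by
    by_contra! hlt
    set x' := max (w.re - 1) ε with hx'
    have hx'0 : 0 < x' := lt_max_of_lt_right hε0
    have hx'1 : x' ≤ 1 := max_le (by linarith) hε1
    have hxx : |x' - (w.re - 1)| ≤ ε := by
      rw [abs_of_nonneg (by linarith [le_max_left (w.re - 1) ε])]
      rw [sub_le_iff_le_add]
      exact max_le (by linarith) (by linarith)
    obtain ⟨hd, -⟩ := hC (w.re - 1) x' w.im (by linarith) (by linarith) hx'0.le hx'1 h3
    obtain ⟨-, hu⟩ := hC x' x' w.im hx'0.le hx'1 hx'0.le hx'1 h3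
    rw [← hw] at hd
    have hz : ‖riemannZeta (1 + x' + I * w.im)‖ < 2 * ε * M := by
      have a := norm_add_le (riemannZeta (1 + x' + I * w.im) - riemannZeta w) (riemannZeta w)
      rw [sub_add_cancel] at a
      have : M * |x' - (w.re - 1)| ≤ M * ε := by gcongr
      linarith
    have hp := one_le_norm_riemannZeta_product hx'0 w.im
    have hk : ‖riemannZeta (1 + x')‖ ≤ K / ε :=
      (hK x' hx'0 hx'1).trans (by gcongr; exact le_max_right _ _)
    have : ‖riemannZeta (1 + x')‖ ^ 3 * ‖riemannZeta (1 + x' + I * w.im)‖ ^ 4 *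
        ‖riemannZeta (1 + x' + 2 * I * w.im)‖ < (K / ε) ^ 3 * (2 * ε * M) ^ 4 * M := by
      calc _ ≤ (K / ε) ^ 3 * ‖riemannZeta (1 + x' + I * w.im)‖ ^ 4 * M := by gcongr
        _ < _ := by gcongr
    have e : (K / ε) ^ 3 * (2 * ε * M) ^ 4 * M = 1 := by
      have : (K / ε) ^ 3 * (2 * ε * M) ^ 4 * M = 16 * K ^ 3 * M ^ 5 * ε := by
        field_simp
        ring
      rw [this, hε]
      field_simp
    linarith
  have hM4 : M ^ 4 = 16 * Real.exp (4 * (C * (4 + 2 * |w.im|))) := by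
    rw [hM, mul_pow, ← Real.exp_nat_mul]
    norm_num
  have hεM : (ε * M)⁻¹ = 256 * K ^ 3 * Real.exp (4 * (C * (4 + 2 * |w.im|))) := by
    have : (ε * M)⁻¹ = 16 * K ^ 3 * M ^ 4 := by
      rw [hε]; field_simp
    rw [this, hM4]; ring
  rw [norm_inv]
  calc ‖riemannZeta w‖⁻¹ ≤ (ε * M)⁻¹ := by gcongr
    _ ≤ Real.exp (256 * K ^ 3) * Real.exp (4 * (C * (4 + 2 * |w.im|))) := by
        rw [hεM]
        gcongr
        linarith [Real.add_one_le_exp (256 * K ^ 3)]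
    _ = Real.exp (256 * K ^ 3 + 4 * (C * (4 + 2 * |w.im|))) := (Real.exp_add _ _).symm
    _ ≤ _ := by
        gcongr
        have a := abs_im_le_norm w
        have : 0 ≤ 256 * K ^ 3 * ‖w‖ := by positivity
        have : C * |w.im| ≤ C * ‖w‖ := by gcongr
        nlinarith [mul_nonneg hC0.le (norm_nonneg w)]

lemma one_third_le_norm_riemannZeta {w : ℂ} (h : 2 ≤ w.re) : 1 / 3 ≤ ‖riemannZeta w‖ := by
  have h1 := norm_riemannZeta_sub_one_le h
  have h2 := norm_sub_le (riemannZeta w) (riemannZeta w - 1)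
  rw [sub_sub_cancel, norm_one] at h2
  nlinarith [Real.pi_lt_d2, Real.pi_gt_three]

lemma norm_riemannZeta_le_two {w : ℂ} (h : 2 ≤ w.re) : ‖riemannZeta w‖ ≤ 2 := by
  have h1 := norm_riemannZeta_sub_one_le h
  have h2 := norm_add_le (riemannZeta w - 1) 1
  rw [sub_add_cancel, norm_one] at h2
  nlinarith [Real.pi_lt_d2, Real.pi_gt_three]

lemma exists_norm_entireXi_inv_le :
    ∃ C, 0 < C ∧ ∀ w : ℂ, 1 ≤ w.re → w.re ≤ 3 → 2 ≤ |w.im| →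
      ‖(entireXi w)⁻¹‖ ≤ Real.exp (C * (1 + ‖w‖)) := by
  obtain ⟨C, hC0, hC⟩ := exists_norm_Gammaℝ_inv_le
  obtain ⟨D, hD0, hD⟩ := exists_norm_riemannZeta_inv_le
  refine ⟨C + (D + 3), by positivity, fun w h1 h2 h3 => ?_⟩
  have hz : ‖(riemannZeta w)⁻¹‖ ≤ Real.exp ((D + 3) * (1 + ‖w‖)) := by
    rcases le_total w.re 2 with h | h
    · refine (hD w h1 h h3).trans ?_
      gcongr
      linarith
    · rw [norm_inv]
      calc ‖riemannZeta w‖⁻¹ ≤ (1 / 3)⁻¹ := by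
            gcongr; exact one_third_le_norm_riemannZeta h
        _ ≤ Real.exp 3 := by linarith [Real.add_one_le_exp 3]
        _ ≤ _ := by
          gcongr
          nlinarith [norm_nonneg w, mul_nonneg hD0.le (norm_nonneg w)]
  have h0 : 1 ≤ ‖w‖ := by linarith [abs_im_le_norm w]
  have h0' : 1 ≤ ‖w - 1‖ := by
    have := abs_im_le_norm (w - 1)
    rw [sub_im, one_im, sub_zero] at this
    linarith
  have w1 : w ≠ 1 := by rintro rfl; norm_num at h3
  rw [entireXi_eq_zeta (by linarith) w1]
  simp only [mul_inv, norm_mul]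
  have i1 : ‖w⁻¹‖ ≤ 1 := by rw [norm_inv]; exact inv_le_one_of_one_le₀ h0
  have i2 : ‖(w - 1)⁻¹‖ ≤ 1 := by rw [norm_inv]; exact inv_le_one_of_one_le₀ h0'
  calc _ ≤ 1 * 1 * (Real.exp (C * (1 + ‖w‖)) * Real.exp ((D + 3) * (1 + ‖w‖))) := by
        gcongr
        exact hC w (by linarith) h2 (by linarith)
    _ = _ := by rw [← Real.exp_add]; ring_nf

lemma exists_norm_betaIntegral_le {v : ℂ} (hv : 0 < v.re) :
    ∃ M, 0 ≤ M ∧ ∀ u : ℂ, 1 ≤ u.re → ‖betaIntegral u v‖ ≤ M := by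
  have hint := (betaIntegral_convergent (u := 1) (by simp) hv).norm
  refine ⟨_, intervalIntegral.integral_nonneg zero_le_one fun _ _ => norm_nonneg _,
    fun u hu => intervalIntegral.norm_integral_le_of_norm_le zero_le_one (.of_forall ?_) hint⟩
  rintro x ⟨h0, h1⟩
  rw [norm_mul, norm_mul]
  gcongr 1
  rw [norm_cpow_eq_rpow_re_of_pos h0, sub_self, cpow_zero, norm_one]
  exact Real.rpow_le_one h0.le h1 (by simpa using hu)

lemma Gammaℝ_sub_one {w : ℂ} (h : 1 < w.re) :
    Gammaℝ (w - 1) = Gammaℝ w * betaIntegral ((w - 1) / 2) (1 / 2) := by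
  have hB := Gamma_mul_Gamma_eq_betaIntegral (s := (w - 1) / 2) (t := 1 / 2)
    (by simp; linarith) (by norm_num)
  have hπ : (π : ℂ) ≠ 0 := ofReal_ne_zero.mpr Real.pi_ne_zero
  rw [show (w - 1) / 2 + 1 / 2 = w / 2 by ring, Gamma_one_half_eq] at hB
  rw [Gammaℝ_def, Gammaℝ_def, mul_assoc, ← hB, show -(w - 1) / 2 = -w / 2 + 1 / 2 by ring,
    cpow_add _ _ hπ]
  ring

/-- The quotient of consecutive shifts of `entireXi`, bounded by `1` on `1 ≤ re w`. -/
noncomputable def xiRatio (w : ℂ) : ℂ := entireXi (w - 1) / entireXi w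

lemma differentiableAt_xiRatio {w : ℂ} (h : 1 ≤ w.re) : DifferentiableAt ℂ xiRatio w := by
  have := entireXi_ne_zero h
  unfold xiRatio
  fun_prop (disch := assumption)

lemma xiRatio_two : xiRatio 2 = 3 / π := by
  rw [xiRatio, entireXi_two, show (2 : ℂ) - 1 = 1 by norm_num, entireXi_one]
  simp

lemma norm_sub_two_le {w : ℂ} (h : 1 ≤ w.re) : ‖w - 2‖ ≤ ‖w‖ := by
  rw [← sq_le_sq₀ (norm_nonneg _) (norm_nonneg _), Complex.sq_norm, Complex.sq_norm, normSq_apply,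
    normSq_apply]
  simp
  linarith

lemma exists_norm_xiRatio_le_of_three_le :
    ∃ M, 0 ≤ M ∧ ∀ w : ℂ, 3 ≤ w.re → ‖xiRatio w‖ ≤ M := by
  obtain ⟨M, hM0, hM⟩ := exists_norm_betaIntegral_le (v := 1 / 2) (by norm_num)
  refine ⟨6 * M, by positivity, fun w h => ?_⟩
  have w0 : w ≠ 0 := by rintro rfl; norm_num at h
  have w1 : w - 1 ≠ 0 := by
    rw [sub_ne_zero]; rintro rfl; norm_num at h
  have w2 : w - 1 ≠ 1 := by
    intro hw
    have := congrArg re hw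
    simp at this; linarith
  have hG := Gammaℝ_ne_zero_of_re_pos (by linarith : 0 < w.re)
  have hz := one_third_le_norm_riemannZeta (by linarith : 2 ≤ w.re)
  have hz0 : riemannZeta w ≠ 0 := by rw [← norm_pos_iff]; linarith
  have hz1 := norm_riemannZeta_le_two (w := w - 1) (by simp; linarith)
  have e : xiRatio w = (w - 2) / w * betaIntegral ((w - 1) / 2) (1 / 2) *
      (riemannZeta (w - 1) * (riemannZeta w)⁻¹) := by
    rw [xiRatio, entireXi_eq_zeta (by linarith) (sub_ne_zero.mp w1),
      entireXi_eq_zeta (by simp; linarith) w2, Gammaℝ_sub_one (by linarith)]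
    field_simp
    ring
  have h1 : ‖(w - 2) / w‖ ≤ 1 := by
    rw [norm_div]
    exact div_le_one_of_le₀ (norm_sub_two_le (by linarith)) (norm_nonneg _)
  have h2 := hM ((w - 1) / 2) (by simp; linarith)
  have h3 : ‖(riemannZeta w)⁻¹‖ ≤ 3 := by
    rw [norm_inv]
    exact inv_le_of_inv_le₀ (by norm_num) (by linarith)
  rw [e, norm_mul, norm_mul, norm_mul]
  calc _ ≤ 1 * M * (2 * 3) := by gcongr
    _ = _ := by ring

lemma two_le_abs_im_of_ten_le_norm {w : ℂ} (h0 : 0 ≤ w.re) (h : w.re ≤ 3) (hw : 10 ≤ ‖w‖) :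
    2 ≤ |w.im| := by
  have := norm_le_abs_re_add_abs_im w
  rw [abs_of_nonneg h0] at this
  linarith

lemma exists_norm_xiRatio_le :
    ∃ C, 0 < C ∧ ∀ w : ℂ, 1 ≤ w.re → 10 ≤ ‖w‖ → ‖xiRatio w‖ ≤ Real.exp (C * (1 + ‖w‖)) := by
  obtain ⟨C, hC0, hC⟩ := exists_norm_entireXi_le 0 2
  obtain ⟨D, hD0, hD⟩ := exists_norm_entireXi_inv_le
  obtain ⟨M, hM0, hM⟩ := exists_norm_xiRatio_le_of_three_le
  refine ⟨2 * C + D + M, by positivity, fun w h hw => ?_⟩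
  rcases le_total w.re 3 with h3 | h3
  · have h1 := hC (w - 1) (by simp; linarith) (by simp; linarith)
    have h2 := hD w h h3 (two_le_abs_im_of_ten_le_norm (by linarith) h3 hw)
    rw [xiRatio, div_eq_mul_inv, norm_mul]
    refine (mul_le_mul h1 h2 (norm_nonneg _) (Real.exp_nonneg _)).trans ?_
    rw [← Real.exp_add]
    refine Real.exp_le_exp.mpr ?_
    have h4 : ‖w - 1‖ ≤ ‖w‖ + 1 := by simpa using norm_sub_le w 1
    nlinarith [mul_le_mul_of_nonneg_left h4 hC0.le, mul_nonneg hC0.le (norm_nonneg w)]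
  · calc ‖xiRatio w‖ ≤ M := hM w h3
      _ ≤ Real.exp M := by linarith [Real.add_one_le_exp M]
      _ ≤ _ := by
        refine Real.exp_le_exp.mpr ?_
        nlinarith [mul_nonneg hM0 (norm_nonneg w), mul_nonneg hC0.le (norm_nonneg w),
          mul_nonneg hD0.le (norm_nonneg w)]

/-- A Phragmén–Lindelöf principle on the half plane `σ ≤ re w`. -/
lemma norm_le_one_of_right_half_plane {f : ℂ → ℂ} {σ T C M : ℝ} (hC : 0 ≤ C)
    (hd : ∀ w : ℂ, σ ≤ w.re → DifferentiableAt ℂ f w)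
    (hg : ∀ w : ℂ, σ ≤ w.re → T ≤ ‖w‖ → ‖f w‖ ≤ Real.exp (C * (1 + ‖w‖)))
    (hr : ∀ x : ℝ, T ≤ x → ‖f x‖ ≤ M)
    (hi : ∀ w : ℂ, w.re = σ → ‖f w‖ ≤ 1) {w : ℂ} (hw : σ ≤ w.re) : ‖f w‖ ≤ 1 := by
  have key := PhragmenLindelof.right_half_plane_of_bounded_on_real (f := fun z => f (σ + z)) (C := 1)
    (z := w - σ) ?_ ?_ ?_ ?_ ?_
  · simpa using key
  · refine DifferentiableOn.diffContOnCl fun z hz => ?_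
    rw [closure_setOfPred_lt_re] at hz
    have := hd (σ + z) (by simpa using hz)
    exact (this.comp z (by fun_prop)).differentiableWithinAt
  · refine ⟨1, one_lt_two, C, .of_bound (Real.exp (C * (1 + |σ|))) ?_⟩
    rw [eventually_inf_principal]
    filter_upwards [tendsto_norm_cobounded_atTop.eventually_ge_atTop (T + |σ|)] with z hz hz0
    have h1 : ‖(σ : ℂ)‖ = |σ| := norm_real σ
    have h2 : ‖(σ : ℂ) + z‖ ≤ |σ| + ‖z‖ := h1 ▸ norm_add_le _ _
    have h3 : ‖z‖ ≤ ‖(σ : ℂ) + z‖ + |σ| := by simpa [h1] using norm_sub_le ((σ : ℂ) + z) σ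
    rw [Real.rpow_one, Real.norm_of_nonneg (Real.exp_nonneg _), ← Real.exp_add]
    refine (hg _ (by simpa using le_of_lt hz0) (by linarith)).trans (Real.exp_le_exp.mpr ?_)
    rw [← mul_add]
    exact mul_le_mul_of_nonneg_left (by linarith) hC
  · refine isBoundedUnder_of_eventually_le (a := M) ?_
    filter_upwards [eventually_ge_atTop (T - σ)] with x hx
    simpa using hr (σ + x) (by linarith)
  · intro x
    exact hi _ (by simp)
  · simpa using hw

lemma norm_xiRatio_le_one {w : ℂ} (h : 1 ≤ w.re) : ‖xiRatio w‖ ≤ 1 := by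
  obtain ⟨C, hC0, hC⟩ := exists_norm_xiRatio_le
  obtain ⟨M, -, hM⟩ := exists_norm_xiRatio_le_of_three_le
  refine norm_le_one_of_right_half_plane hC0.le (fun w => differentiableAt_xiRatio) hC
    (fun x hx => hM x (by simp; linarith)) (fun z hz => ?_) h
  rw [xiRatio, norm_div, norm_entireXi_reflect z 2 (by simpa using hz) (z - 1) (by push_cast; ring)]
  exact div_self_le_one _

lemma norm_entireXi_div_le_one {w : ℂ} (h : 2 ≤ w.re) :
    ‖entireXi (w - 2) / entireXi w‖ ≤ 1 := by
  have h1 : 1 ≤ (w - 1).re := by simp; linarith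
  have e : entireXi (w - 2) / entireXi w = xiRatio (w - 1) * xiRatio w := by
    have := entireXi_ne_zero h1
    rw [xiRatio, xiRatio, show w - 1 - 1 = w - 2 by ring]
    field_simp
  rw [e, norm_mul]
  exact mul_le_one₀ (norm_xiRatio_le_one h1) (norm_nonneg _) (norm_xiRatio_le_one (by linarith))

lemma exists_norm_entireXi_div_le :
    ∃ C, 0 < C ∧ ∀ w : ℂ, 3 / 2 ≤ w.re → 10 ≤ ‖w‖ →
      ‖entireXi (w - 2) / entireXi w‖ ≤ Real.exp (C * (1 + ‖w‖)) := by
  obtain ⟨C, hC0, hC⟩ := exists_norm_entireXi_le (-1) 0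
  obtain ⟨D, hD0, hD⟩ := exists_norm_entireXi_inv_le
  refine ⟨3 * C + D, by positivity, fun w h hw => ?_⟩
  rcases le_total w.re 2 with h2 | h2
  · have h1 := hC (w - 2) (by simp; linarith) (by simp; linarith)
    have h3 := hD w (by linarith) (by linarith)
      (two_le_abs_im_of_ten_le_norm (by linarith) (by linarith) hw)
    rw [div_eq_mul_inv, norm_mul]
    refine (mul_le_mul h1 h3 (norm_nonneg _) (Real.exp_nonneg _)).trans ?_
    rw [← Real.exp_add]
    refine Real.exp_le_exp.mpr ?_
    have h4 : ‖w - 2‖ ≤ ‖w‖ + 2 := by simpa using norm_sub_le w 2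
    nlinarith [mul_le_mul_of_nonneg_left h4 hC0.le, mul_nonneg hC0.le (norm_nonneg w)]
  · exact (norm_entireXi_div_le_one h2).trans (Real.one_le_exp (by positivity))

/-- The coefficient of `w` in the polynomial factor of `edgeXi`. -/
noncomputable def slopeCoeff : ℝ := π / 6 - 1 / 2

/-- The constant term of the polynomial factor of `edgeXi`. -/
noncomputable def constCoeff : ℝ := 3 / 2 - π / 3

lemma slopeCoeff_gt : 0.0235 < slopeCoeff := by
  have := Real.pi_gt_d6
  rw [slopeCoeff]; norm_num at *; linarith

lemma slopeCoeff_lt : slopeCoeff < 0.024 := by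
  have := Real.pi_lt_d6
  rw [slopeCoeff]; norm_num at *; linarith

lemma constCoeff_eq : constCoeff = 1 / 2 - 2 * slopeCoeff := by
  rw [constCoeff, slopeCoeff]; ring

/-- The Schwarz–Pick inequality for `xiRatio` on `1 < re w`, centred at `w = 2`. -/
lemma norm_xiRatio_schwarz {w : ℂ} (h : 1 < w.re) :
    ‖xiRatio w - (3 / π : ℝ)‖ * ‖w‖ ≤ ‖1 - (3 / π : ℝ) * xiRatio w‖ * ‖w - 2‖ := by
  set q : ℝ := 3 / π with hq
  have hq0 : 0 < q := by positivity
  have hq1 : q < 1 := by rw [hq, div_lt_one Real.pi_pos]; exact Real.pi_gt_three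
  have hden : ∀ v : ℂ, 1 ≤ v.re → 0 < ‖1 - q * xiRatio v‖ := by
    intro v hv
    have h1 := norm_sub_norm_le 1 (q * xiRatio v)
    rw [norm_one, norm_mul, norm_real, Real.norm_of_nonneg hq0.le] at h1
    nlinarith [norm_xiRatio_le_one hv]
  have hball : ∀ z ∈ Metric.ball (0 : ℂ) 1, 1 - z ≠ 0 ∧ 1 ≤ (2 / (1 - z)).re := by
    intro z hz
    rw [mem_ball_zero_iff, ← sq_lt_one_iff₀ (norm_nonneg _), Complex.sq_norm, normSq_apply] at hz
    have hz1 : 1 - z ≠ 0 := by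
      rw [sub_ne_zero]; rintro rfl; norm_num at hz
    refine ⟨hz1, ?_⟩
    have hp := normSq_pos.mpr hz1
    rw [div_re]
    simp only [re_ofNat, im_ofNat, zero_mul, zero_div, add_zero]
    rw [le_div_iff₀ hp, normSq_apply]
    simp
    nlinarith
  have key := Complex.norm_le_norm_of_mapsTo_ball (R := 1) (z := (w - 2) / w)
    (f := fun z => (xiRatio (2 / (1 - z)) - q) / (1 - q * xiRatio (2 / (1 - z)))) ?_ ?_ ?_ ?_
  · have hw0 : w ≠ 0 := by rintro rfl; norm_num at h
    have : 2 / (1 - (w - 2) / w) = w := by field_simp; ring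
    simp only [this] at key
    rw [norm_div, norm_div, div_le_div_iff₀ (hden w h.le) (norm_pos_iff.mpr hw0)] at key
    linarith
  · intro z hz
    obtain ⟨h1, h2⟩ := hball z hz
    have h3 := differentiableAt_xiRatio h2
    have h4 := norm_pos_iff.mp (hden _ h2)
    have h5 : DifferentiableAt ℂ (fun z => xiRatio (2 / (1 - z))) z :=
      
      h3.comp (f := fun z => 2 / (1 - z)) z (by fun_prop (disch := assumption))
    exact ((h5.sub_const _).div (by fun_prop) h4).differentiableWithinAt
  · intro z hz
    obtain ⟨h1, h2⟩ := hball z hz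
    have h3 := norm_xiRatio_le_one h2
    rw [mem_closedBall_zero_iff, norm_div]
    refine div_le_one_of_le₀ ?_ (norm_nonneg _)
    rw [← sq_le_sq₀ (norm_nonneg _) (norm_nonneg _), Complex.sq_norm, Complex.sq_norm]
    rw [← sq_le_one_iff₀ (norm_nonneg _), Complex.sq_norm] at h3
    simp only [normSq_apply] at h3 ⊢
    simp
    nlinarith [mul_nonneg (sub_nonneg.mpr h3) (by nlinarith : 0 ≤ 1 - q ^ 2)]
  · simp [xiRatio_two, hq]
  · rw [norm_div, div_lt_one (by rw [norm_pos_iff]; rintro rfl; norm_num at h),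
      ← sq_lt_sq₀ (norm_nonneg _) (norm_nonneg _), Complex.sq_norm, Complex.sq_norm, normSq_apply,
      normSq_apply]
    simp
    linarith

/-- The quotient of `edgeXi` by `entireXi`. -/
noncomputable def edgeFactor (w : ℂ) : ℂ := slopeCoeff * w + constCoeff + xiRatio w / 2

lemma schwarz_lt_of_near_neg_one {a q x y σ t : ℝ} (ha : 0.0235 < a) (ha' : a < 0.024)
    (hq : 0.95 < q) (hq' : q < 1) (hσ : 3 / 2 ≤ σ) (hn : x * x + y * y ≤ 1)
    (hx : x = -1 + 2 * a * (2 - σ)) (hy : y = -2 * (a * t)) :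
    (1 - x ^ 2 - y ^ 2) * (1 - q ^ 2) * ((σ - 2) ^ 2 + t ^ 2) <
      ((x - q) ^ 2 + y ^ 2) * (4 * (σ - 1)) := by
  norm_num at ha ha' hq
  have hσ2 : σ ≤ 2 := by
    by_contra! h
    have : 2 * a * (2 - σ) < 0 := mul_neg_of_pos_of_neg (by linarith) (by linarith)
    nlinarith only [this, hx, hn, mul_self_nonneg y]
  have hx2 : x ≤ -97 / 100 := by
    have : 2 * a * (2 - σ) ≤ 2 * (3 / 125) * (1 / 2) := by gcongr; linarith
    linarith
  have hxsq : 94 / 100 ≤ x ^ 2 := by nlinarith only [hx2]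
  have hy2 : y ^ 2 ≤ 6 / 100 := by linarith [sq y, sq x]
  have ht : t ^ 2 ≤ 30 := by
    have e : y ^ 2 = 4 * a ^ 2 * t ^ 2 := by rw [hy]; ring
    have e2 : 5 / 10000 ≤ a ^ 2 := by nlinarith only [ha]
    nlinarith only [mul_nonneg (sub_nonneg.mpr e2) (sq_nonneg t), e, hy2]
  have hA : 36 / 10 ≤ (x - q) ^ 2 + y ^ 2 := by nlinarith only [hx2, hq, sq_nonneg y]
  have hB : 1 - x ^ 2 - y ^ 2 ≤ 6 / 100 := by linarith [sq_nonneg y]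
  have hD : 0 ≤ 1 - q ^ 2 := by nlinarith only [hq, hq']
  have hD' : 1 - q ^ 2 ≤ 1 / 10 := by nlinarith only [hq]
  have hE : (σ - 2) ^ 2 + t ^ 2 ≤ 31 := by nlinarith only [hσ, hσ2, ht]
  calc (1 - x ^ 2 - y ^ 2) * (1 - q ^ 2) * ((σ - 2) ^ 2 + t ^ 2)
      ≤ 6 / 100 * (1 / 10) * 31 := by gcongr
    _ < 36 / 10 * 2 := by norm_num
    _ ≤ _ := by gcongr; linarith

lemma edgeFactor_ne_zero {w : ℂ} (h : 3 / 2 ≤ w.re) : edgeFactor w ≠ 0 := by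
  intro h0
  have hQ : xiRatio w = -2 * (slopeCoeff * w + constCoeff) := by
    rw [edgeFactor] at h0
    linear_combination 2 * h0
  have hre : (xiRatio w).re = -1 + 2 * slopeCoeff * (2 - w.re) := by
    rw [hQ, constCoeff_eq]; simp; ring
  have him : (xiRatio w).im = -2 * (slopeCoeff * w.im) := by rw [hQ]; simp
  have hn := norm_xiRatio_le_one (w := w) (by linarith)
  have hs := norm_xiRatio_schwarz (w := w) (by linarith)
  have hq0 : 0.95 < 3 / π := by
    rw [lt_div_iff₀ Real.pi_pos]; have := Real.pi_lt_d2; norm_num at *; linarith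
  have hq1 : 3 / π < 1 := by rw [div_lt_one Real.pi_pos]; exact Real.pi_gt_three
  generalize 3 / π = q at *
  rw [← sq_le_one_iff₀ (norm_nonneg _), Complex.sq_norm, normSq_apply] at hn
  rw [← sq_le_sq₀ (by positivity) (by positivity), mul_pow, mul_pow] at hs
  simp only [Complex.sq_norm, normSq_apply, sub_re, sub_im, mul_re, mul_im, ofReal_re, ofReal_im,
    one_re, one_im, re_ofNat, im_ofNat, zero_mul, sub_zero, add_zero, zero_sub] at hs
  have key := schwarz_lt_of_near_neg_one slopeCoeff_gt slopeCoeff_lt hq0 hq1 h hn hre him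
  nlinarith only [hs, key]

/-- Half of the numerator of `wengSL3`: the whole is `edgeXi w + edgeXi (3 - w)` at `w = 3 s`. -/
noncomputable def edgeXi (w : ℂ) : ℂ :=
  (slopeCoeff * w + constCoeff) * entireXi w + entireXi (w - 1) / 2

lemma edgeXi_eq {w : ℂ} (h : 1 ≤ w.re) : edgeXi w = edgeFactor w * entireXi w := by
  have := entireXi_ne_zero h
  rw [edgeXi, edgeFactor, xiRatio]
  field_simp

lemma edgeXi_conj (w : ℂ) : edgeXi (conj w) = conj (edgeXi w) := by
  have h := entireXi_conj (w - 1)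
  have h2 : conj (2 : ℂ) = 2 := map_ofNat _ 2
  simp only [map_sub, map_one] at h
  simp [edgeXi, entireXi_conj, h, h2]

lemma edgeXi_three_sub (w : ℂ) :
    edgeXi (3 - w) = (slopeCoeff * (3 - w) + constCoeff) * entireXi (w - 2) + entireXi (w - 1) / 2 := by
  rw [edgeXi, ← entireXi_one_sub (w - 2), ← entireXi_one_sub (w - 1)]
  ring_nf

lemma differentiable_edgeXi : Differentiable ℂ edgeXi := by
  have := differentiable_entireXi
  unfold edgeXi
  fun_prop

/-- The quotient of the two halves of the numerator, of norm `1` on `re w = 3 / 2`. -/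
noncomputable def edgeRatio (w : ℂ) : ℂ := edgeXi (3 - w) / edgeXi w

lemma edgeXi_ne_zero {w : ℂ} (h : 3 / 2 ≤ w.re) : edgeXi w ≠ 0 := by
  rw [edgeXi_eq (by linarith)]
  exact mul_ne_zero (edgeFactor_ne_zero h) (entireXi_ne_zero (by linarith))

lemma differentiableAt_edgeRatio {w : ℂ} (h : 3 / 2 ≤ w.re) : DifferentiableAt ℂ edgeRatio w := by
  have := edgeXi_ne_zero h
  have := differentiable_edgeXi
  unfold edgeRatio
  fun_prop (disch := assumption)

lemma edgeRatio_eq {w : ℂ} (h : 1 ≤ w.re) :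
    edgeRatio w = ((slopeCoeff * (3 - w) + constCoeff) * (entireXi (w - 2) / entireXi w) +
      xiRatio w / 2) / edgeFactor w := by
  have := entireXi_ne_zero h
  rw [edgeRatio, edgeXi_three_sub, edgeXi_eq h, xiRatio]
  field_simp

lemma norm_edgeFactor_ge {w : ℂ} (h : 1 ≤ w.re) : 0.0235 * ‖w‖ - 1 ≤ ‖edgeFactor w‖ := by
  have h1 := norm_xiRatio_le_one h
  have ha := slopeCoeff_gt
  have ha' := slopeCoeff_lt
  have hb := constCoeff_eq
  have e : (slopeCoeff : ℂ) * w = edgeFactor w - xiRatio w / 2 - constCoeff := by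
    rw [edgeFactor]; ring
  have h2 : ‖(slopeCoeff : ℂ) * w‖ ≤ ‖edgeFactor w‖ + ‖xiRatio w / 2‖ + ‖(constCoeff : ℂ)‖ := by
    rw [e]
    exact (norm_sub_le _ _).trans (by gcongr; exact norm_sub_le _ _)
  norm_num at ha ha'
  rw [norm_mul, norm_div, norm_real, norm_real, Complex.norm_ofNat, Real.norm_of_nonneg (by linarith),
    Real.norm_of_nonneg (by linarith)] at h2
  have : 0.0235 * ‖w‖ ≤ slopeCoeff * ‖w‖ := by norm_num; gcongr
  linarith

lemma norm_edgeRatio_le {w : ℂ} {A : ℝ} (h : 3 / 2 ≤ w.re) (hw : 100 ≤ ‖w‖) (hA : 1 ≤ A)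
    (hS : ‖entireXi (w - 2) / entireXi w‖ ≤ A) : ‖edgeRatio w‖ ≤ 3 * A := by
  have h1 := norm_edgeFactor_ge (w := w) (by linarith)
  have hQ := norm_xiRatio_le_one (w := w) (by linarith)
  have ha := slopeCoeff_gt
  have ha' := slopeCoeff_lt
  have hb := constCoeff_eq
  norm_num at ha ha' h1
  have h2 : ‖(slopeCoeff : ℂ) * (3 - w) + constCoeff‖ ≤ 0.024 * (3 + ‖w‖) + 0.5 := by
    refine (norm_add_le _ _).trans ?_
    rw [norm_mul, norm_real, norm_real, Real.norm_of_nonneg (by linarith),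
      Real.norm_of_nonneg (by linarith)]
    have h3 : ‖3 - w‖ ≤ 3 + ‖w‖ := by simpa using norm_sub_le 3 w
    norm_num
    gcongr
    linarith
  rw [edgeRatio_eq (by linarith), norm_div, div_le_iff₀ (by linarith)]
  calc _ ≤ (0.024 * (3 + ‖w‖) + 0.5) * A + 1 / 2 * A := by
        refine (norm_add_le _ _).trans ?_
        rw [norm_mul, norm_div _ (2 : ℂ), Complex.norm_ofNat]
        gcongr
        linarith
    _ ≤ 3 * A * (47 / 2000 * ‖w‖ - 1) := by
        norm_num
        nlinarith
    _ ≤ _ := by gcongr; linarith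

lemma norm_edgeRatio_le_one {w : ℂ} (h : 3 / 2 ≤ w.re) : ‖edgeRatio w‖ ≤ 1 := by
  obtain ⟨C, hC0, hC⟩ := exists_norm_entireXi_div_le
  refine norm_le_one_of_right_half_plane (T := 100) (C := C + 2) (M := 3) (by positivity)
    (fun w => differentiableAt_edgeRatio) (fun w hw hT => ?_) (fun x hx => ?_) (fun z hz => ?_) h
  · refine (norm_edgeRatio_le hw hT (Real.one_le_exp (by positivity)) (hC w hw (by linarith))).trans ?_
    calc 3 * Real.exp (C * (1 + ‖w‖)) ≤ Real.exp 2 * Real.exp (C * (1 + ‖w‖)) := by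
          gcongr
          linarith [Real.add_one_le_exp 2]
      _ ≤ _ := by
        rw [← Real.exp_add]
        refine Real.exp_le_exp.mpr ?_
        linarith [norm_nonneg w]
  · have := norm_edgeRatio_le (w := x) (A := 1) (by simp; linarith)
      (by rw [norm_real]; exact hx.trans (le_abs_self x)) le_rfl
      (norm_entireXi_div_le_one (by simp; linarith))
    linarith
  · have : 3 - z = conj z := by
      apply Complex.ext
      · simp [hz]; norm_num
      · simp
    rw [edgeRatio, this, edgeXi_conj, norm_div, norm_conj]
    exact div_self_le_one _

lemma edgeXi_add_edgeXi_three_sub_ne_zero {w : ℂ} (h : 3 / 2 < w.re) :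
    edgeXi w + edgeXi (3 - w) ≠ 0 := by
  intro h0
  have hE := edgeXi_ne_zero h.le
  have hR : edgeRatio w = -1 := by
    rw [edgeRatio, div_eq_iff hE]
    linear_combination h0
  have hopen : IsOpen {z : ℂ | 3 / 2 < z.re} := isOpen_lt continuous_const continuous_re
  have hconst := Complex.eqOn_of_isPreconnected_of_isMaxOn_norm (f := edgeRatio) (c := w)
    (convex_halfSpace_re_gt (3 / 2)).isPreconnected hopen
    (fun z hz => (differentiableAt_edgeRatio (le_of_lt hz)).differentiableWithinAt) h
    (fun z hz => by
      simpa [hR] using norm_edgeRatio_le_one (le_of_lt hz))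
  have h2 : edgeRatio 2 = -1 := by
    rw [← hR]
    exact hconst (show (3 / 2 : ℝ) < (2 : ℂ).re by norm_num)
  rw [edgeRatio, div_eq_iff (edgeXi_ne_zero (by norm_num)), show (3 : ℂ) - 2 = 1 by norm_num] at h2
  have h00 : entireXi 0 = 1 := by rw [← entireXi_one, ← entireXi_one_sub 0, sub_zero]
  have hsum : ((slopeCoeff + constCoeff + 1 / 2 + ((slopeCoeff * 2 + constCoeff) * (π / 3) + 1 / 2) : ℝ) : ℂ)
      = 0 := by
    rw [edgeXi, edgeXi, sub_self, show (2 : ℂ) - 1 = 1 by norm_num, entireXi_one, entireXi_two, h00]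
      at h2
    push_cast
    linear_combination h2
  have hpos := ofReal_eq_zero.mp hsum
  have ha := slopeCoeff_lt
  norm_num at ha
  rw [constCoeff_eq, show slopeCoeff * 2 + (1 / 2 - 2 * slopeCoeff) = 1 / 2 by ring] at hpos
  linarith [Real.pi_pos]

lemma wengSL3_mul_eq {w : ℂ} (h0 : w ≠ 0) (h1 : w ≠ 1) (h2 : w ≠ 2) (h3 : w ≠ 3) :
    wengSL3 (w / 3) * (w * (w - 1) * (w - 2) * (w - 3)) = edgeXi w + edgeXi (3 - w) := by
  have h1' := sub_ne_zero.mpr h1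
  have h2' := sub_ne_zero.mpr h2
  have h3' := sub_ne_zero.mpr h3
  have e0 := entireXi_eq h0 h1
  have e1 := entireXi_eq (w := w - 1) h1' (by rw [← sub_ne_zero]; convert h2' using 1; ring)
  have e2 := entireXi_eq (w := w - 2) h2' (by rw [← sub_ne_zero]; convert h3' using 1; ring)
  rw [edgeXi_three_sub, edgeXi, e0, e1, e2, wengSL3, completedRiemannZeta_two,
    mul_div_cancel₀ w three_ne_zero, slopeCoeff, constCoeff]
  push_cast
  field_simp
  ring

end

/-- The Riemann Hypothesis for Weng's `SL(3)` zeta (Suzuki): all zeros lie on `Re s = 1/2`. -/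
theorem wengSL3_riemann_hypothesis (s : ℂ) (hs : s ∉ ({0, 1/3, 2/3, 1} : Set ℂ))
    (hzero : wengSL3 s = 0) : s.re = 1/2 := by
  simp only [Set.mem_insert_iff, Set.mem_singleton_iff, not_or] at hs
  obtain ⟨h0, h1, h2, h3⟩ := hs
  have key := wengSL3_mul_eq (w := 3 * s) (by simpa using h0)
    (fun h => h1 (by rw [← h]; ring)) (fun h => h2 (by rw [← h]; ring))
    (fun h => h3 (by linear_combination h / 3))
  rw [mul_div_cancel_left₀ s three_ne_zero, hzero, zero_mul] at key
  rcases lt_trichotomy s.re (1 / 2) with h | h | h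
  · refine absurd ?_ (edgeXi_add_edgeXi_three_sub_ne_zero (w := 3 - 3 * s) (by simp; linarith))
    rw [sub_sub_cancel, add_comm]
    exact key.symm
  · exact h
  · exact absurd key.symm (edgeXi_add_edgeXi_three_sub_ne_zero (by simp; linarith))
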